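/- Let σ ∈ [0,1], κ ≥ 0, w, w' ∈ ℝ, let E be a finite-dimensional normed vector space, let f ∈ H_{σ,κ}^{w'}(E) (respectively f ∈ E_{σ,κ}^{w'}(E)), and let g = (g₁,g₂) ∈ H_{σ,κ}^{w}(ℝ^{2n}) (with g₁, g₂ : ℝ^{2n} → ℝ^n) be such that there exist C, c > 0 and r ≥ 0 with: ⟨g₁(x,ζ)⟩ ≥ c⟨x⟩⟨ζ⟩^{-r} for all (x,ζ) in case σ ≠ 0, and ⟨g₂(x,ζ)⟩ ≤ C⟨ζ⟩ for all (x,ζ). Then f ∘ g ∈ H_{σ, κ+|w|+rσ}^{|w|+|w'|}(E) (respectively f ∘ g ∈ E_{σ, κ+|w|+rσ}^{|w'|}(E)). -/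

import Mathlib

open MeasureTheory
open scoped BigOperators

noncomputable section

/-- Japanese bracket `⟨v⟩ = (1 + ‖v‖²)^(1/2)` (with the Euclidean norm). -/
def jb {n : ℕ} (v : Fin n → ℝ) : ℝ := Real.sqrt (1 + ∑ i, (v i) ^ 2)

/-- Japanese bracket of a pair of vectors, `⟨(x,y)⟩`. -/
def jb2 {n m : ℕ} (x : Fin n → ℝ) (y : Fin m → ℝ) : ℝ :=
  Real.sqrt (1 + ∑ i, (x i) ^ 2 + ∑ j, (y j) ^ 2)

/-- Euclidean inner product `⟨ϑ, ζ⟩`. -/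
def ip {n : ℕ} (ϑ ζ : Fin n → ℝ) : ℝ := ∑ i, ϑ i * ζ i

/-- Partial derivative in the `i`-th coordinate direction. -/
def pd {n : ℕ} {E : Type*} [NormedAddCommGroup E] [NormedSpace ℝ E]
    (i : Fin n) (f : (Fin n → ℝ) → E) : (Fin n → ℝ) → E :=
  fun x => fderiv ℝ f x (Pi.single i 1)

/-- Iterated partial derivative `∂^ν` along the multi-index `ν`. -/
def pdm {n : ℕ} {E : Type*} [NormedAddCommGroup E] [NormedSpace ℝ E]
    (ν : Fin n → ℕ) (f : (Fin n → ℝ) → E) : (Fin n → ℝ) → E :=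
  (List.finRange n).foldr (fun i g => (pd i)^[ν i] g) f

/-- Mixed partial derivative `∂_x^α ∂_y^β` of a function of two vector variables. -/
def pdm2 {n m : ℕ} {E : Type*} [NormedAddCommGroup E] [NormedSpace ℝ E]
    (α : Fin n → ℕ) (β : Fin m → ℕ) (f : (Fin n → ℝ) → (Fin m → ℝ) → E) :
    (Fin n → ℝ) → (Fin m → ℝ) → E :=
  fun x y => pdm α (fun x' => pdm β (f x') y) x

/-- Mixed partial derivative `∂_x^α ∂_y^β ∂_z^γ` of a function of three vector variables. -/
def pdm3 {n m k : ℕ} {E : Type*} [NormedAddCommGroup E] [NormedSpace ℝ E]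
    (α : Fin n → ℕ) (β : Fin m → ℕ) (γ : Fin k → ℕ)
    (f : (Fin n → ℝ) → (Fin m → ℝ) → (Fin k → ℝ) → E) :
    (Fin n → ℝ) → (Fin m → ℝ) → (Fin k → ℝ) → E :=
  fun x y z => pdm α (fun x' => pdm β (fun y' => pdm γ (f x' y') z) y) x

/-- Length `|ν|` of a multi-index. -/
def msize {n : ℕ} (ν : Fin n → ℕ) : ℕ := ∑ i, ν i

/-- The class `G_σ(ℝ^n, E)`: smooth functions whose `ν`-th derivative is
`O(⟨v⟩^{-σ(|ν|-1)})` for every `ν ≠ 0`. -/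
def GsigmaCl {n : ℕ} {E : Type*} [NormedAddCommGroup E] [NormedSpace ℝ E]
    (σ : ℝ) (f : (Fin n → ℝ) → E) : Prop :=
  ContDiff ℝ (⊤ : ℕ∞) f ∧ ∀ ν : Fin n → ℕ, ν ≠ 0 → ∃ C > 0, ∀ v,
    ‖pdm ν f v‖ ≤ C * jb v ^ (-(σ * ((msize ν : ℝ) - 1)))

/-- The class `S_σ(ℝ^n)`: smooth real functions whose `ν`-th derivative is
`O(⟨v⟩^{-σ|ν|})` for every `ν`. -/
def SsigmaCl {n : ℕ} (σ : ℝ) (f : (Fin n → ℝ) → ℝ) : Prop :=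
  ContDiff ℝ (⊤ : ℕ∞) f ∧ ∀ ν : Fin n → ℕ, ∃ C > 0, ∀ v,
    |pdm ν f v| ≤ C * jb v ^ (-(σ * (msize ν : ℝ)))

/-- `G_σ^×(ℝ^p)`: diffeomorphisms `g` of `ℝ^p` with `g` and `g⁻¹` in `G_σ`. -/
def GsigmaX {p : ℕ} (σ : ℝ) (g : (Fin p → ℝ) → (Fin p → ℝ)) : Prop :=
  ∃ h : (Fin p → ℝ) → (Fin p → ℝ),
    Function.LeftInverse h g ∧ Function.RightInverse h g ∧ GsigmaCl σ g ∧ GsigmaCl σ h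

/-- The class `O_M(ℝ^n, E)`: smooth functions with polynomially bounded derivatives. -/
def OMCl {n : ℕ} {E : Type*} [NormedAddCommGroup E] [NormedSpace ℝ E]
    (f : (Fin n → ℝ) → E) : Prop :=
  ContDiff ℝ (⊤ : ℕ∞) f ∧ ∀ ν : Fin n → ℕ, ∃ C > 0, ∃ k : ℕ, ∀ v,
    ‖pdm ν f v‖ ≤ C * jb v ^ (k : ℝ)

/-- `O_M^×(ℝ^p, ℝ^p)`: diffeomorphisms `g` of `ℝ^p` with `g` and `g⁻¹` in `O_M`. -/
def OMX {p : ℕ} (g : (Fin p → ℝ) → (Fin p → ℝ)) : Prop :=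
  ∃ h : (Fin p → ℝ) → (Fin p → ℝ),
    Function.LeftInverse h g ∧ Function.RightInverse h g ∧ OMCl g ∧ OMCl h

/-- The symbol space `S_σ^{l,m}(ℝ^{2n}, E)`. -/
def Ssym {n : ℕ} {E : Type*} [NormedAddCommGroup E] [NormedSpace ℝ E]
    (σ l m : ℝ) (a : (Fin n → ℝ) → (Fin n → ℝ) → E) : Prop :=
  ContDiff ℝ (⊤ : ℕ∞) (fun q : (Fin n → ℝ) × (Fin n → ℝ) => a q.1 q.2) ∧
  ∀ α β : Fin n → ℕ, ∃ C > 0, ∀ x ϑ,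
    ‖pdm2 α β a x ϑ‖ ≤ C * jb x ^ (σ * (l - (msize α : ℝ))) * jb ϑ ^ (m - (msize β : ℝ))

/-- The amplitude space `Π_{σ,κ}^{l,w,m}(ℝ^{3n}, E)`. -/
def Amp {n : ℕ} {E : Type*} [NormedAddCommGroup E] [NormedSpace ℝ E]
    (σ κ l w m : ℝ) (a : (Fin n → ℝ) → (Fin n → ℝ) → (Fin n → ℝ) → E) : Prop :=
  ContDiff ℝ (⊤ : ℕ∞)
    (fun q : ((Fin n → ℝ) × (Fin n → ℝ)) × (Fin n → ℝ) => a q.1.1 q.1.2 q.2) ∧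
  ∀ α β γ : Fin n → ℕ, ∃ C > 0, ∀ x ζ ϑ,
    ‖pdm3 α β γ a x ζ ϑ‖ ≤
      C * jb x ^ (σ * (l - ((msize α + msize β : ℕ) : ℝ))) *
        jb ζ ^ (w + κ * ((msize α + msize β : ℕ) : ℝ)) * jb ϑ ^ (m - (msize γ : ℝ))

/-- The space `H_{σ,κ}^{w}(E)` of smooth functions on `ℝ^{2n}`. -/
def Hsp {n : ℕ} {F : Type*} [NormedAddCommGroup F] [NormedSpace ℝ F]
    (σ κ w : ℝ) (g : (Fin n → ℝ) → (Fin n → ℝ) → F) : Prop :=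
  ContDiff ℝ (⊤ : ℕ∞) (fun q : (Fin n → ℝ) × (Fin n → ℝ) => g q.1 q.2) ∧
  ∀ α β : Fin n → ℕ, ¬(α = 0 ∧ β = 0) → ∃ C > 0, ∀ x ζ,
    ‖pdm2 α β g x ζ‖ ≤ C * jb x ^ (-(σ * (((msize α + msize β : ℕ) : ℝ) - 1))) *
      jb ζ ^ (w + κ * (((msize α + msize β : ℕ) : ℝ) - 1))

/-- The space `E_{σ,κ}^{w}(E)` of smooth functions on `ℝ^{2n}`. -/
def Esp {n : ℕ} {F : Type*} [NormedAddCommGroup F] [NormedSpace ℝ F]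
    (σ κ w : ℝ) (g : (Fin n → ℝ) → (Fin n → ℝ) → F) : Prop :=
  ContDiff ℝ (⊤ : ℕ∞) (fun q : (Fin n → ℝ) × (Fin n → ℝ) => g q.1 q.2) ∧
  ∀ α β : Fin n → ℕ, ∃ C > 0, ∀ x ζ,
    ‖pdm2 α β g x ζ‖ ≤ C * jb x ^ (-(σ * ((msize α + msize β : ℕ) : ℝ))) *
      jb ζ ^ (w + κ * ((msize α + msize β : ℕ) : ℝ))

/-- Jacobian determinant of a map `ℝ^p → ℝ^p`. -/
def Jdet {p : ℕ} (g : (Fin p → ℝ) → (Fin p → ℝ)) : (Fin p → ℝ) → ℝ :=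
  fun v => LinearMap.det (fderiv ℝ g v).toLinearMap

/-- The seminorm `q_{p,(α,β)}(K) = sup ⟨(x,y)⟩^p |∂^{(α,β)} K (x,y)|`. -/
def qSem {n : ℕ} (p : ℕ) (α β : Fin n → ℕ)
    (K : (Fin n → ℝ) → (Fin n → ℝ) → ℂ) : ℝ :=
  ⨆ q : (Fin n → ℝ) × (Fin n → ℝ), jb2 q.1 q.2 ^ p * ‖pdm2 α β K q.1 q.2‖

/-- Mixed partial derivative `∂_r^α ∂_θ^β` of a function of two real variables. -/
def pd2 (α β : ℕ) (F : ℝ → ℝ → ℝ) (r θ : ℝ) : ℝ :=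
  iteratedDeriv α (fun r' => iteratedDeriv β (fun θ' => F r' θ') θ) r

/-- Smooth real function on `ℝ` with all derivatives bounded. -/
def BddSmooth (a : ℝ → ℝ) : Prop :=
  ContDiff ℝ (⊤ : ℕ∞) a ∧ ∀ k : ℕ, ∃ C : ℝ, ∀ t, |iteratedDeriv k a t| ≤ C

/-- Inverse hyperbolic cosine, `arcosh x = log (x + √(x²-1))`. -/
def arcosh (x : ℝ) : ℝ := Real.log (x + Real.sqrt (x ^ 2 - 1))


section aux

open scoped ContDiff

/-- Basis vectors of `ℝ^n × ℝ^n`. -/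
def auxEv {n : ℕ} : Fin n ⊕ Fin n → (Fin n → ℝ) × (Fin n → ℝ) :=
  Sum.elim (fun i => (Pi.single i 1, 0)) (fun j => (0, Pi.single j 1))

/-- Iterated directional derivatives along a list of basis vectors. -/
def auxDL {n : ℕ} {F : Type*} [NormedAddCommGroup F] [NormedSpace ℝ F]
    (L : List (Fin n ⊕ Fin n)) (G : (Fin n → ℝ) × (Fin n → ℝ) → F) :
    (Fin n → ℝ) × (Fin n → ℝ) → F :=
  L.foldr (fun i g q => fderiv ℝ g q (auxEv i)) G

variable {n : ℕ} {F : Type*} [NormedAddCommGroup F] [NormedSpace ℝ F]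

lemma auxDL_cons (i : Fin n ⊕ Fin n) (L : List (Fin n ⊕ Fin n))
    (G : (Fin n → ℝ) × (Fin n → ℝ) → F) :
    auxDL (i :: L) G = fun q => fderiv ℝ (auxDL L G) q (auxEv i) := rfl

lemma auxDL_append (L M : List (Fin n ⊕ Fin n))
    (G : (Fin n → ℝ) × (Fin n → ℝ) → F) :
    auxDL (L ++ M) G = auxDL L (auxDL M G) := by
  simp [auxDL, List.foldr_append]

lemma auxDL_smooth (L : List (Fin n ⊕ Fin n))
    {G : (Fin n → ℝ) × (Fin n → ℝ) → F} (hG : ContDiff ℝ ∞ G) :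
    ContDiff ℝ ∞ (auxDL L G) := by
  induction L with
  | nil => exact hG
  | cons i L ih =>
    rw [auxDL_cons]
    exact (ih.fderiv_right (m := ∞) (by simp)).clm_apply contDiff_const

lemma auxDL_perm {L M : List (Fin n ⊕ Fin n)} (h : L.Perm M)
    {G : (Fin n → ℝ) × (Fin n → ℝ) → F} (hG : ContDiff ℝ ∞ G) :
    auxDL L G = auxDL M G := by
  induction h with
  | nil => rfl
  | cons x _ ih => rw [auxDL_cons, auxDL_cons, ih]
  | trans _ _ ih1 ih2 => rw [ih1, ih2]
  | swap x y l =>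
    funext q
    have hs := auxDL_smooth l hG
    have hd : Differentiable ℝ (fderiv ℝ (auxDL l G)) :=
      (hs.fderiv_right (m := ∞) (by simp)).differentiable (by simp)
    have key : ∀ a b : Fin n ⊕ Fin n, auxDL (a :: b :: l) G q
        = fderiv ℝ (fderiv ℝ (auxDL l G)) q (auxEv a) (auxEv b) := by
      intro a b
      rw [auxDL_cons, auxDL_cons]
      simp only
      rw [fderiv_clm_apply (hd q) (by fun_prop)]
      simp
    rw [key, key]
    exact (hs.contDiffAt.isSymmSndFDerivAt (by
      rw [minSmoothness_of_isRCLikeNormedField]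
      exact WithTop.coe_le_coe.2 (le_top : (2 : ℕ∞) ≤ ⊤))) _ _

lemma auxDL_eq_iter (L : List (Fin n ⊕ Fin n))
    {G : (Fin n → ℝ) × (Fin n → ℝ) → F} (hG : ContDiff ℝ ∞ G)
    (q : (Fin n → ℝ) × (Fin n → ℝ)) :
    auxDL L G q = iteratedFDeriv ℝ L.length G q (fun k => auxEv (L.get k)) := by
  induction L generalizing q with
  | nil => simp [auxDL]
  | cons i L ih =>
    rw [auxDL_cons]
    have : auxDL L G = fun q => iteratedFDeriv ℝ L.length G q (fun k => auxEv (L.get k)) := by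
      funext q; exact ih q
    rw [this]
    simp only [List.length_cons]
    rw [iteratedFDeriv_succ_apply_left]
    have hd : DifferentiableAt ℝ (iteratedFDeriv ℝ L.length G) q :=
      (hG.differentiable_iteratedFDeriv (by exact_mod_cast WithTop.coe_lt_top _)) q
    rw [fderiv_continuousMultilinear_apply_const_apply hd]
    rfl

lemma aux_pd_inr (i : Fin n) {G : (Fin n → ℝ) × (Fin n → ℝ) → F} (hG : ContDiff ℝ ∞ G)
    (x : Fin n → ℝ) :
    pd i (fun ζ => G (x, ζ)) = fun ζ => auxDL [Sum.inr i] G (x, ζ) := by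
  funext ζ
  have h1 : HasFDerivAt G (fderiv ℝ G (x, ζ)) (x, ζ) :=
    (hG.differentiable (by simp) _).hasFDerivAt
  have h2 := h1.comp ζ (hasFDerivAt_prodMk_right (𝕜 := ℝ) x ζ)
  have h3 : fderiv ℝ (fun ζ => G (x, ζ)) ζ = _ := h2.fderiv
  simp only [pd, h3, auxDL, auxEv]
  simp

lemma aux_pd_inl (i : Fin n) {G : (Fin n → ℝ) × (Fin n → ℝ) → F} (hG : ContDiff ℝ ∞ G)
    (ζ : Fin n → ℝ) :
    pd i (fun x => G (x, ζ)) = fun x => auxDL [Sum.inl i] G (x, ζ) := by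
  funext x
  have h1 : HasFDerivAt G (fderiv ℝ G (x, ζ)) (x, ζ) :=
    (hG.differentiable (by simp) _).hasFDerivAt
  have h2 := h1.comp x (hasFDerivAt_prodMk_left (𝕜 := ℝ) x ζ)
  have h3 : fderiv ℝ (fun x => G (x, ζ)) x = _ := h2.fderiv
  simp only [pd, h3, auxDL, auxEv]
  simp

lemma aux_iter_inr (i : Fin n) (k : ℕ) {G : (Fin n → ℝ) × (Fin n → ℝ) → F}
    (hG : ContDiff ℝ ∞ G) (x : Fin n → ℝ) :
    (pd i)^[k] (fun ζ => G (x, ζ))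
      = fun ζ => auxDL (List.replicate k (Sum.inr i)) G (x, ζ) := by
  induction k with
  | zero => rfl
  | succ k ih =>
    rw [Function.iterate_succ_apply', ih, aux_pd_inr i (auxDL_smooth _ hG)]
    rfl

lemma aux_iter_inl (i : Fin n) (k : ℕ) {G : (Fin n → ℝ) × (Fin n → ℝ) → F}
    (hG : ContDiff ℝ ∞ G) (ζ : Fin n → ℝ) :
    (pd i)^[k] (fun x => G (x, ζ))
      = fun x => auxDL (List.replicate k (Sum.inl i)) G (x, ζ) := by
  induction k with
  | zero => rfl
  | succ k ih =>
    rw [Function.iterate_succ_apply', ih, aux_pd_inl i (auxDL_smooth _ hG)]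
    rfl

lemma aux_pdm_inr (ν : Fin n → ℕ) {G : (Fin n → ℝ) × (Fin n → ℝ) → F}
    (hG : ContDiff ℝ ∞ G) (x : Fin n → ℝ) :
    pdm ν (fun ζ => G (x, ζ)) = fun ζ =>
      auxDL ((List.finRange n).flatMap (fun i => List.replicate (ν i) (Sum.inr i))) G (x, ζ) := by
  unfold pdm
  generalize List.finRange n = l
  induction l with
  | nil => rfl
  | cons i l ih =>
    rw [List.foldr_cons, ih, aux_iter_inr i _ (auxDL_smooth _ hG), List.flatMap_cons,
      auxDL_append]

lemma aux_pdm_inl (ν : Fin n → ℕ) {G : (Fin n → ℝ) × (Fin n → ℝ) → F}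
    (hG : ContDiff ℝ ∞ G) (ζ : Fin n → ℝ) :
    pdm ν (fun x => G (x, ζ)) = fun x =>
      auxDL ((List.finRange n).flatMap (fun i => List.replicate (ν i) (Sum.inl i))) G (x, ζ) := by
  unfold pdm
  generalize List.finRange n = l
  induction l with
  | nil => rfl
  | cons i l ih =>
    rw [List.foldr_cons, ih, aux_iter_inl i _ (auxDL_smooth _ hG), List.flatMap_cons,
      auxDL_append]

/-- The canonical list of basis directions attached to a pair of multi-indices. -/
def auxList (α β : Fin n → ℕ) : List (Fin n ⊕ Fin n) :=
  (List.finRange n).flatMap (fun i => List.replicate (α i) (Sum.inl i)) ++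
    (List.finRange n).flatMap (fun i => List.replicate (β i) (Sum.inr i))

lemma aux_pdm2 (α β : Fin n → ℕ) (g : (Fin n → ℝ) → (Fin n → ℝ) → F)
    (hG : ContDiff ℝ ∞ (fun q : (Fin n → ℝ) × (Fin n → ℝ) => g q.1 q.2)) (x ζ : Fin n → ℝ) :
    pdm2 α β g x ζ = auxDL (auxList α β) (fun q => g q.1 q.2) (x, ζ) := by
  unfold pdm2
  have h : ∀ x', pdm β (g x') = fun ζ => auxDL _ (fun q => g q.1 q.2) (x', ζ) :=
    fun x' => aux_pdm_inr β hG x'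
  simp only [h]
  rw [aux_pdm_inl α (auxDL_smooth _ hG) ζ, auxList, auxDL_append]

lemma auxList_length (α β : Fin n → ℕ) : (auxList α β).length = msize α + msize β := by
  have : ∀ ν : Fin n → ℕ, ((List.finRange n).map ν).sum = ∑ i, ν i := by
    intro ν
    rw [← List.ofFn_eq_map, List.sum_ofFn]
  simp [auxList, msize, List.length_flatMap, this]

lemma auxList_perm (L : List (Fin n ⊕ Fin n)) :
    ∃ α β : Fin n → ℕ, L.Perm (auxList α β) := by
  let _ : BEq (Fin n ⊕ Fin n) := instBEqOfDecidableEq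
  refine ⟨fun i => L.count (Sum.inl i), fun i => L.count (Sum.inr i), ?_⟩
  rw [List.perm_iff_count]
  have : ∀ ν : Fin n → ℕ, ((List.finRange n).map ν).sum = ∑ i, ν i := by
    intro ν
    rw [← List.ofFn_eq_map, List.sum_ofFn]
  rintro (a | a) <;>
    simp [auxList, List.count_flatMap, Function.comp_def, List.count_replicate, this]

lemma aux_norm_ev (i : Fin n ⊕ Fin n) : ‖(auxEv i : (Fin n → ℝ) × (Fin n → ℝ))‖ ≤ 1 := by
  rcases i with i | i <;> simp [auxEv, Prod.norm_def, Pi.norm_single]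

/-- coordinates -/
def auxCo (v : (Fin n → ℝ) × (Fin n → ℝ)) : Fin n ⊕ Fin n → ℝ := Sum.elim v.1 v.2

lemma auxCo_le (v : (Fin n → ℝ) × (Fin n → ℝ)) (i : Fin n ⊕ Fin n) : ‖auxCo v i‖ ≤ ‖v‖ := by
  rcases i with i | i
  · exact (norm_le_pi_norm v.1 i).trans (norm_fst_le v)
  · exact (norm_le_pi_norm v.2 i).trans (norm_snd_le v)

lemma auxCo_sum (v : (Fin n → ℝ) × (Fin n → ℝ)) : v = ∑ i, auxCo v i • auxEv i := by
  rw [Fintype.sum_sum_type]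
  ext k <;> simp [auxCo, auxEv, Prod.fst_sum, Prod.snd_sum, Finset.sum_apply, Pi.single_apply]

lemma aux_multi {N : ℕ}
    (M : ContinuousMultilinearMap ℝ (fun _ : Fin N => (Fin n → ℝ) × (Fin n → ℝ)) F) :
    ‖M‖ ≤ ∑ r : Fin N → Fin n ⊕ Fin n, ‖M (fun k => auxEv (r k))‖ := by
  classical
  refine ContinuousMultilinearMap.opNorm_le_bound (by positivity) (fun m => ?_)
  have h : M m = ∑ r : Fin N → Fin n ⊕ Fin n,
      (∏ k, auxCo (m k) (r k)) • M (fun k => auxEv (r k)) := by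
    conv_lhs => rw [show m = fun k => ∑ i, auxCo (m k) i • auxEv i from
      funext fun k => auxCo_sum (m k)]
    rw [ContinuousMultilinearMap.map_sum]
    refine Finset.sum_congr rfl fun r _ => ?_
    rw [ContinuousMultilinearMap.map_smul_univ]
  rw [h, Finset.sum_mul]
  refine (norm_sum_le _ _).trans (Finset.sum_le_sum fun r _ => ?_)
  rw [norm_smul, mul_comm, norm_prod]
  gcongr with k
  exact auxCo_le _ _

/-- Bounds on all mixed partial derivatives of order `N` amount to a bound on
the `N`-th Fréchet derivative. -/
lemma aux_bound_iff (N : ℕ) (g : (Fin n → ℝ) → (Fin n → ℝ) → F)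
    (hG : ContDiff ℝ ∞ (fun q : (Fin n → ℝ) × (Fin n → ℝ) => g q.1 q.2))
    (W : (Fin n → ℝ) → (Fin n → ℝ) → ℝ) (hW : ∀ x ζ, 0 ≤ W x ζ) :
    (∀ α β : Fin n → ℕ, msize α + msize β = N → ∃ C > 0, ∀ x ζ,
      ‖pdm2 α β g x ζ‖ ≤ C * W x ζ) ↔
    ∃ C > 0, ∀ x ζ, ‖iteratedFDeriv ℝ N (fun q : (Fin n → ℝ) × (Fin n → ℝ) => g q.1 q.2) (x, ζ)‖
      ≤ C * W x ζ := by
  constructor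
  · intro h
    have h' : ∀ r : Fin N → Fin n ⊕ Fin n, ∃ C > 0, ∀ x ζ,
        ‖iteratedFDeriv ℝ N (fun q : (Fin n → ℝ) × (Fin n → ℝ) => g q.1 q.2) (x, ζ)
          (fun k => auxEv (r k))‖ ≤ C * W x ζ := by
      intro r
      obtain ⟨L, hL, hr⟩ : ∃ L : List (Fin n ⊕ Fin n), ∃ hL : L.length = N,
          ∀ k : Fin N, r k = L.get (Fin.cast hL.symm k) :=
        ⟨List.ofFn r, by simp, by intro k; simp⟩
      subst hL
      obtain ⟨α, β, hp⟩ := auxList_perm L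
      obtain ⟨C, hC, hb⟩ := h _ _ ((auxList_length _ _).symm.trans hp.length_eq.symm)
      refine ⟨C, hC, fun x ζ => ?_⟩
      have := hb x ζ
      rw [aux_pdm2 _ _ g hG, ← auxDL_perm hp hG, auxDL_eq_iter L hG] at this
      convert this using 5
      rename_i k
      rw [hr k]; rfl
    choose C hC hb using h'
    refine ⟨∑ r, C r + 1, by have : 0 ≤ ∑ r, C r := Finset.sum_nonneg fun r _ => (hC r).le
                             linarith, fun x ζ => ?_⟩
    refine (aux_multi _).trans ((Finset.sum_le_sum fun r _ => hb r x ζ).trans ?_)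
    rw [← Finset.sum_mul]
    have := hW x ζ
    gcongr
    linarith
  · rintro ⟨C, hC, hb⟩ α β hab
    refine ⟨C, hC, fun x ζ => ?_⟩
    rw [aux_pdm2 _ _ g hG, auxDL_eq_iter _ hG]
    have hl : (auxList α β).length = N := (auxList_length α β).trans hab
    subst hl
    refine le_trans ?_ (hb x ζ)
    refine (ContinuousMultilinearMap.le_opNorm _ _).trans ?_
    refine mul_le_of_le_one_right (norm_nonneg _) ?_
    exact Finset.prod_le_one (fun _ _ => norm_nonneg _) (fun _ _ => aux_norm_ev _)

lemma aux_comp0 {V U : Type*} [NormedAddCommGroup V] [NormedSpace ℝ V]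
    [NormedAddCommGroup U] [NormedSpace ℝ U] {f : U → F} {g : V → U}
    (hf : ContDiff ℝ ∞ f) (hg : ContDiff ℝ ∞ g) (N : ℕ) (q : V) {A lam D : ℝ}
    (hlam : 0 < lam)
    (hbf : ∀ i ≤ N, lam ^ i * ‖iteratedFDeriv ℝ i f (g q)‖ ≤ A)
    (hbg : ∀ i, 1 ≤ i → i ≤ N → ‖iteratedFDeriv ℝ i g q‖ ≤ lam * D ^ i) :
    ‖iteratedFDeriv ℝ N (f ∘ g) q‖ ≤ N.factorial * A * D ^ N := by
  have hle : ∀ i : ℕ, ((i : ℕ) : WithTop ℕ∞) ≤ ∞ := fun i => by exact_mod_cast le_top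
  have hcomp : f ∘ g = (fun z => f (lam • z)) ∘ (lam⁻¹ • g) := by
    funext v
    simp [smul_smul, hlam.ne']
  rw [hcomp]
  have c1 : ContDiff ℝ ∞ (fun z => f (lam • z)) := hf.comp (contDiff_const_smul lam)
  have c2 : ContDiff ℝ ∞ (lam⁻¹ • g) := contDiff_const.smul hg
  refine norm_iteratedFDeriv_comp_le (N := ∞) c1 c2 (hle N) q ?_ ?_
  · intro i hi
    rw [iteratedFDeriv_comp_const_smul lam (hf.of_le (hle i))]
    have : lam • (lam⁻¹ • g) q = g q := by simp [smul_smul, hlam.ne']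
    simp only [this]
    rw [norm_smul, norm_pow, Real.norm_of_nonneg hlam.le]
    exact hbf i hi
  · intro i h1 hi
    rw [iteratedFDeriv_const_smul_apply (hg.of_le (hle i)).contDiffAt, norm_smul, norm_inv,
      Real.norm_of_nonneg hlam.le, inv_mul_le_iff₀ hlam]
    exact hbg i h1 hi

lemma aux_comp {V U : Type*} [NormedAddCommGroup V] [NormedSpace ℝ V]
    [NormedAddCommGroup U] [NormedSpace ℝ U] {f : U → F} {g : V → U}
    (hf : ContDiff ℝ ∞ f) (hg : ContDiff ℝ ∞ g) (s N : ℕ) (hs : s ≤ 1) (hsN : s ≤ N)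
    (q : V) {A lam D : ℝ} (hlam : 0 < lam) (hA : 0 ≤ A)
    (hbf : ∀ i, s ≤ i → i ≤ N → lam ^ i * ‖iteratedFDeriv ℝ i f (g q)‖ ≤ A)
    (hbg : ∀ i, 1 ≤ i → i ≤ N → ‖iteratedFDeriv ℝ i g q‖ ≤ lam * D ^ i) :
    ‖iteratedFDeriv ℝ N (f ∘ g) q‖ ≤ N.factorial * A * D ^ N := by
  have hle : ∀ i : ℕ, ((i : ℕ) : WithTop ℕ∞) ≤ ∞ := fun i => by exact_mod_cast le_top
  rcases Nat.eq_zero_or_pos s with rfl | hs0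
  · exact aux_comp0 hf hg N q hlam (fun i hi => hbf i (Nat.zero_le _) hi) hbg
  · obtain rfl : s = 1 := by omega
    have hf' : ContDiff ℝ ∞ (f - fun _ => f (g q)) := hf.sub contDiff_const
    have hder : ∀ i, i ≠ 0 → ∀ u, iteratedFDeriv ℝ i (f - fun _ => f (g q)) u
        = iteratedFDeriv ℝ i f u := by
      intro i hi u
      rw [iteratedFDeriv_sub_apply (hf.of_le (hle i)).contDiffAt contDiff_const.contDiffAt,
        iteratedFDeriv_const_of_ne hi]
      simp
    have h := aux_comp0 (A := A) (D := D) hf' hg N q hlam (fun i hi => by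
      rcases Nat.eq_zero_or_pos i with rfl | h0
      · simpa using hA
      · rw [hder i h0.ne']
        exact hbf i h0 hi) hbg
    have hc : f ∘ g = ((f - fun _ => f (g q)) ∘ g) + fun _ => f (g q) := by
      funext v; simp
    rw [hc, iteratedFDeriv_add_apply ((hf'.comp hg).of_le (hle N)).contDiffAt
      contDiff_const.contDiffAt, iteratedFDeriv_const_of_ne (by omega)]
    simpa using h

lemma aux_jb_one (v : Fin n → ℝ) : 1 ≤ jb v := by
  unfold jb
  rw [Real.one_le_sqrt]
  have : 0 ≤ ∑ i, (v i) ^ 2 := Finset.sum_nonneg fun i _ => sq_nonneg _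
  linarith

/-- weight estimate for the outer function -/
lemma aux_weight {σ κ w' C c r p Y H X Z : ℝ} (hσ : 0 ≤ σ) (hκ : 0 ≤ κ) (hp : 0 ≤ p)
    (hC : 0 < C) (hc : 0 < c) (hY : 1 ≤ Y) (hH : 1 ≤ H) (hX : 1 ≤ X) (hZ : 1 ≤ Z)
    (hlow : σ ≠ 0 → c * X * Z ^ (-r) ≤ Y) (hup : H ≤ C * Z) :
    Y ^ (-(σ * p)) * H ^ (w' + κ * p) ≤
      (c ^ (-(σ * p)) * C ^ (|w'| + κ * p)) *
        (Z ^ |w'| * (X ^ σ * Z ^ (-(r * σ + κ))) ^ (-p)) := by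
  have hX0 : 0 < X := by linarith
  have hZ0 : 0 < Z := by linarith
  have hY0 : 0 < Y := by linarith
  have hH0 : 0 < H := by linarith
  have h1 : Y ^ (-(σ * p)) ≤ c ^ (-(σ * p)) * (X ^ (-(σ * p)) * Z ^ (r * (σ * p))) := by
    rcases eq_or_ne σ 0 with rfl | hs
    · simp
    · refine (Real.rpow_le_rpow_of_nonpos (by positivity) (hlow hs)
        (neg_nonpos.2 (mul_nonneg hσ hp))).trans (le_of_eq ?_)
      rw [Real.mul_rpow (by positivity) (by positivity), Real.mul_rpow hc.le hX0.le,
        ← Real.rpow_mul hZ0.le, mul_assoc]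
      congr 3
      ring
  have he : 0 ≤ |w'| + κ * p := add_nonneg (abs_nonneg _) (mul_nonneg hκ hp)
  have h2 : H ^ (w' + κ * p) ≤ C ^ (|w'| + κ * p) * Z ^ (|w'| + κ * p) := by
    rw [← Real.mul_rpow hC.le hZ0.le]
    refine (Real.rpow_le_rpow_of_exponent_le hH ?_).trans (Real.rpow_le_rpow hH0.le hup he)
    linarith [le_abs_self w']
  refine (mul_le_mul h1 h2 (by positivity) (by positivity)).trans (le_of_eq ?_)
  rw [Real.mul_rpow (by positivity) (by positivity), ← Real.rpow_mul hX0.le,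
    ← Real.rpow_mul hZ0.le]
  rw [show σ * -p = -(σ * p) by ring]
  have : Z ^ (r * (σ * p)) * Z ^ (|w'| + κ * p) = Z ^ |w'| * Z ^ (-(r * σ + κ) * -p) := by
    rw [← Real.rpow_add hZ0, ← Real.rpow_add hZ0]
    congr 1
    ring
  linear_combination (c ^ (-(σ * p)) * C ^ (|w'| + κ * p) * X ^ (-(σ * p))) * this

/-- weight estimate for the inner function -/
lemma aux_weight_g {σ κ w r B X Z : ℝ} (hσ : 0 ≤ σ) (hr : 0 ≤ r)
    (hB : 1 ≤ B) (hX : 1 ≤ X) (hZ : 1 ≤ Z) (i : ℕ) (hi : 1 ≤ i) :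
    B * (X ^ (-(σ * ((i : ℝ) - 1))) * Z ^ (w + κ * ((i : ℝ) - 1))) ≤
      (X ^ σ * Z ^ (-(r * σ + κ))) * (B * X ^ (-σ) * Z ^ (κ + |w| + r * σ)) ^ i := by
  have hX0 : 0 < X := by linarith
  have hZ0 : 0 < Z := by linarith
  have hi' : (1 : ℝ) ≤ i := by exact_mod_cast hi
  have h1 : B ≤ B ^ i := le_self_pow₀ hB (by omega)
  have e1 : X ^ (-(σ * ((i : ℝ) - 1))) = X ^ σ * (X ^ (-σ)) ^ i := by
    rw [← Real.rpow_natCast (X ^ (-σ)), ← Real.rpow_mul hX0.le, ← Real.rpow_add hX0]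
    congr 1
    ring
  have e2 : Z ^ (w + κ * ((i : ℝ) - 1)) ≤
      Z ^ (-(r * σ + κ)) * (Z ^ (κ + |w| + r * σ)) ^ i := by
    rw [← Real.rpow_natCast (Z ^ (κ + |w| + r * σ)), ← Real.rpow_mul hZ0.le,
      ← Real.rpow_add hZ0]
    refine Real.rpow_le_rpow_of_exponent_le hZ ?_
    have a1 := le_abs_self w
    have a2 : 0 ≤ r * σ * ((i : ℝ) - 1) := mul_nonneg (mul_nonneg hr hσ) (by linarith)
    have a3 : 0 ≤ |w| * ((i : ℝ) - 1) := mul_nonneg (abs_nonneg w) (by linarith)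
    nlinarith
  rw [e1]
  calc _ ≤ B ^ i * (X ^ σ * (X ^ (-σ)) ^ i *
        (Z ^ (-(r * σ + κ)) * (Z ^ (κ + |w| + r * σ)) ^ i)) := by
        gcongr
    _ = _ := by ring

lemma aux_unif {P : ℕ → ℝ → Prop} (hmono : ∀ k a b, a ≤ b → P k a → P k b) (s : ℕ)
    (h : ∀ k, s ≤ k → ∃ A > 0, P k A) (N : ℕ) :
    ∃ A : ℝ, 1 ≤ A ∧ ∀ k, s ≤ k → k ≤ N → P k A := by
  have h' : ∀ k, ∃ A > 0, s ≤ k → P k A := fun k => by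
    by_cases hk : s ≤ k
    · obtain ⟨A, hA, hp⟩ := h k hk
      exact ⟨A, hA, fun _ => hp⟩
    · exact ⟨1, one_pos, fun h => absurd h hk⟩
  choose A hA hp using h'
  refine ⟨1 + ∑ k ∈ Finset.range (N + 1), A k, ?_, fun k hk hkN => hmono k (A k) _ ?_ (hp k hk)⟩
  · have : 0 ≤ ∑ k ∈ Finset.range (N + 1), A k := Finset.sum_nonneg fun k _ => (hA k).le
    linarith
  · have := Finset.single_le_sum (f := A) (fun k _ => (hA k).le)
      (Finset.mem_range.2 (Nat.lt_succ_of_le hkN))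
    linarith

lemma aux_main (σ κ w w' : ℝ) (hσ : 0 ≤ σ) (hκ : 0 ≤ κ)
    (f : (Fin n → ℝ) × (Fin n → ℝ) → F)
    (g : (Fin n → ℝ) × (Fin n → ℝ) → (Fin n → ℝ) × (Fin n → ℝ))
    (hfs : ContDiff ℝ ∞ f) (hgs : ContDiff ℝ ∞ g)
    (C c r : ℝ) (hC : 0 < C) (hc : 0 < c) (hr : 0 ≤ r)
    (hlow : σ ≠ 0 → ∀ x ζ, c * jb x * jb ζ ^ (-r) ≤ jb (g (x, ζ)).1)
    (hup : ∀ x ζ, jb (g (x, ζ)).2 ≤ C * jb ζ)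
    (hg : ∀ k : ℕ, 1 ≤ k → ∃ A > 0, ∀ x ζ, ‖iteratedFDeriv ℝ k g (x, ζ)‖ ≤
      A * (jb x ^ (-(σ * ((k : ℝ) - 1))) * jb ζ ^ (w + κ * ((k : ℝ) - 1))))
    (s : ℕ) (hs : s ≤ 1)
    (hf : ∀ k : ℕ, s ≤ k → ∃ A > 0, ∀ x ζ, ‖iteratedFDeriv ℝ k f (x, ζ)‖ ≤
      A * (jb x ^ (-(σ * ((k : ℝ) - s))) * jb ζ ^ (w' + κ * ((k : ℝ) - s))))
    (N : ℕ) (hN : s ≤ N) :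
    ∃ A > 0, ∀ x ζ, ‖iteratedFDeriv ℝ N (f ∘ g) (x, ζ)‖ ≤
      A * (jb x ^ (-(σ * ((N : ℝ) - s))) *
        jb ζ ^ (s * |w| + |w'| + (κ + |w| + r * σ) * ((N : ℝ) - s))) := by
  have hj : ∀ v : Fin n → ℝ, 0 < jb v := fun v => one_pos.trans_le (aux_jb_one v)
  obtain ⟨B, hB, hBg⟩ := aux_unif (P := fun k A => ∀ x ζ, ‖iteratedFDeriv ℝ k g (x, ζ)‖ ≤
      A * (jb x ^ (-(σ * ((k : ℝ) - 1))) * jb ζ ^ (w + κ * ((k : ℝ) - 1))))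
    (fun k a b hab h x ζ => (h x ζ).trans (by have := hj x; have := hj ζ; gcongr)) 1 hg N
  obtain ⟨A, hA, hAf⟩ := aux_unif (P := fun k A => ∀ x ζ,
      (jb x ^ σ * jb ζ ^ (-(r * σ + κ))) ^ k * ‖iteratedFDeriv ℝ k f (g (x, ζ))‖ ≤
        A * (jb ζ ^ |w'| * (jb x ^ σ * jb ζ ^ (-(r * σ + κ))) ^ s))
    (fun k a b hab h x ζ => (h x ζ).trans (by have := hj x; have := hj ζ; gcongr)) s
    (fun k hk => by
      obtain ⟨A, hA, hb⟩ := hf k hk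
      have hp : (0 : ℝ) ≤ (k : ℝ) - s := by
        have : (s : ℝ) ≤ k := by exact_mod_cast hk
        linarith
      refine ⟨A * (c ^ (-(σ * ((k : ℝ) - s))) * C ^ (|w'| + κ * ((k : ℝ) - s))),
        by positivity, fun x ζ => ?_⟩
      have hx := hj x
      have hz := hj ζ
      have h1 := hb (g (x, ζ)).1 (g (x, ζ)).2
      have h2 := aux_weight (w' := w') hσ hκ hp hC hc (aux_jb_one (g (x, ζ)).1)
        (aux_jb_one (g (x, ζ)).2) (aux_jb_one x) (aux_jb_one ζ) (fun h => hlow h x ζ) (hup x ζ)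
      have h3 := h1.trans (mul_le_mul_of_nonneg_left h2 hA.le)
      have hl : 0 < jb x ^ σ * jb ζ ^ (-(r * σ + κ)) := by positivity
      set lam := jb x ^ σ * jb ζ ^ (-(r * σ + κ)) with hlam
      have e : lam ^ k * lam ^ (-((k : ℝ) - s)) = lam ^ s := by
        rw [← Real.rpow_natCast lam k, ← Real.rpow_natCast lam s, ← Real.rpow_add hl]
        congr 1
        ring
      refine (mul_le_mul_of_nonneg_left h3 (by positivity)).trans (le_of_eq ?_)
      rw [← e]
      ring) N
  refine ⟨N.factorial * A * B ^ N, by positivity, fun x ζ => ?_⟩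
  have hx := hj x
  have hz := hj ζ
  have hl : 0 < jb x ^ σ * jb ζ ^ (-(r * σ + κ)) := by positivity
  have key := aux_comp hfs hgs s N hs hN (x, ζ) hl
    (A := A * (jb ζ ^ |w'| * (jb x ^ σ * jb ζ ^ (-(r * σ + κ))) ^ s))
    (D := B * jb x ^ (-σ) * jb ζ ^ (κ + |w| + r * σ)) (by positivity)
    (fun i h1 h2 => hAf i h1 h2 x ζ)
    (fun i h1 h2 => (hBg i h1 h2 x ζ).trans
      (aux_weight_g hσ hr hB (aux_jb_one x) (aux_jb_one ζ) i h1))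
  refine key.trans (le_of_eq ?_)
  have e1 : jb x ^ (-(σ * ((N : ℝ) - s))) = (jb x ^ σ) ^ s * (jb x ^ (-σ)) ^ N := by
    rw [← Real.rpow_natCast _ s, ← Real.rpow_natCast _ N, ← Real.rpow_mul hx.le,
      ← Real.rpow_mul hx.le, ← Real.rpow_add hx]
    congr 1
    ring
  have e2 : jb ζ ^ (s * |w| + |w'| + (κ + |w| + r * σ) * ((N : ℝ) - s)) =
      jb ζ ^ |w'| * (jb ζ ^ (-(r * σ + κ))) ^ s * (jb ζ ^ (κ + |w| + r * σ)) ^ N := by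
    rw [← Real.rpow_natCast _ s, ← Real.rpow_natCast _ N, ← Real.rpow_mul hz.le,
      ← Real.rpow_mul hz.le, ← Real.rpow_add hz, ← Real.rpow_add hz]
    congr 1
    ring
  rw [e1, e2]
  ring

lemma aux_msize (α β : Fin n → ℕ) : ¬(α = 0 ∧ β = 0) ↔ 1 ≤ msize α + msize β := by
  have : ∀ ν : Fin n → ℕ, msize ν = 0 ↔ ν = 0 := fun ν => by
    simp [msize, funext_iff]
  rw [← this, ← this]
  omega

lemma aux_Hsp_iff (σ κ w : ℝ) (g : (Fin n → ℝ) → (Fin n → ℝ) → F) :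
    Hsp σ κ w g ↔ ContDiff ℝ ∞ (fun q : (Fin n → ℝ) × (Fin n → ℝ) => g q.1 q.2) ∧
      ∀ k : ℕ, 1 ≤ k → ∃ A > 0, ∀ x ζ,
      ‖iteratedFDeriv ℝ k (fun q : (Fin n → ℝ) × (Fin n → ℝ) => g q.1 q.2) (x, ζ)‖ ≤
      A * (jb x ^ (-(σ * ((k : ℝ) - 1))) * jb ζ ^ (w + κ * ((k : ℝ) - 1))) := by
  have hj : ∀ v : Fin n → ℝ, 0 < jb v := fun v => one_pos.trans_le (aux_jb_one v)
  unfold Hsp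
  refine and_congr_right fun hG => ?_
  have key := fun k : ℕ => aux_bound_iff k g hG
    (fun x ζ => jb x ^ (-(σ * ((k : ℝ) - 1))) * jb ζ ^ (w + κ * ((k : ℝ) - 1)))
    (fun x ζ => by have := hj x; have := hj ζ; positivity)
  simp only [← key]
  constructor
  · intro h k hk α β hab
    subst hab
    obtain ⟨A, hA, hb⟩ := h α β ((aux_msize α β).2 hk)
    exact ⟨A, hA, fun x ζ => by rw [← mul_assoc]; exact hb x ζ⟩
  · intro h α β hab
    obtain ⟨A, hA, hb⟩ := h _ ((aux_msize α β).1 hab) α β rfl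
    exact ⟨A, hA, fun x ζ => by rw [mul_assoc]; exact hb x ζ⟩

lemma aux_Esp_iff (σ κ w : ℝ) (g : (Fin n → ℝ) → (Fin n → ℝ) → F) :
    Esp σ κ w g ↔ ContDiff ℝ ∞ (fun q : (Fin n → ℝ) × (Fin n → ℝ) => g q.1 q.2) ∧
      ∀ k : ℕ, ∃ A > 0, ∀ x ζ,
      ‖iteratedFDeriv ℝ k (fun q : (Fin n → ℝ) × (Fin n → ℝ) => g q.1 q.2) (x, ζ)‖ ≤
      A * (jb x ^ (-(σ * (k : ℝ))) * jb ζ ^ (w + κ * (k : ℝ))) := by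
  have hj : ∀ v : Fin n → ℝ, 0 < jb v := fun v => one_pos.trans_le (aux_jb_one v)
  unfold Esp
  refine and_congr_right fun hG => ?_
  have key := fun k : ℕ => aux_bound_iff k g hG
    (fun x ζ => jb x ^ (-(σ * (k : ℝ))) * jb ζ ^ (w + κ * (k : ℝ)))
    (fun x ζ => by have := hj x; have := hj ζ; positivity)
  simp only [← key]
  constructor
  · intro h k α β hab
    subst hab
    obtain ⟨A, hA, hb⟩ := h α β
    exact ⟨A, hA, fun x ζ => by rw [← mul_assoc]; exact hb x ζ⟩
  · intro h α β
    obtain ⟨A, hA, hb⟩ := h _ α β rfl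
    exact ⟨A, hA, fun x ζ => by rw [mul_assoc]; exact hb x ζ⟩

end aux

/-- Composition behaviour of the spaces `H_{σ,κ}^w` and `E_{σ,κ}^w`:
if `f ∈ H_{σ,κ}^{w'}` (resp. `E_{σ,κ}^{w'}`) and `g = (g₁,g₂) ∈ H_{σ,κ}^{w}(ℝ^{2n})`
with `⟨g₁⟩ ≳ ⟨x⟩⟨ζ⟩^{-r}` (when `σ ≠ 0`) and `⟨g₂⟩ ≲ ⟨ζ⟩`, then
`f ∘ g ∈ H_{σ,κ+|w|+rσ}^{|w|+|w'|}` (resp. `E_{σ,κ+|w|+rσ}^{|w'|}`). -/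
theorem statement11 {n : ℕ} {E : Type*} [NormedAddCommGroup E] [NormedSpace ℝ E]
    [FiniteDimensional ℝ E]
    (σ κ w w' : ℝ) (hσ : σ ∈ Set.Icc (0 : ℝ) 1) (hκ : 0 ≤ κ)
    (f : (Fin n → ℝ) → (Fin n → ℝ) → E)
    (g₁ g₂ : (Fin n → ℝ) → (Fin n → ℝ) → (Fin n → ℝ))
    (hg : Hsp σ κ w (fun x ζ => ((g₁ x ζ, g₂ x ζ) : (Fin n → ℝ) × (Fin n → ℝ))))
    (C c r : ℝ) (hC : 0 < C) (hc : 0 < c) (hr : 0 ≤ r)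
    (hlow : σ ≠ 0 → ∀ x ζ, c * jb x * jb ζ ^ (-r) ≤ jb (g₁ x ζ))
    (hup : ∀ x ζ, jb (g₂ x ζ) ≤ C * jb ζ) :
    (Hsp σ κ w' f → Hsp σ (κ + |w| + r * σ) (|w| + |w'|)
      (fun x ζ => f (g₁ x ζ) (g₂ x ζ))) ∧
    (Esp σ κ w' f → Esp σ (κ + |w| + r * σ) |w'|
      (fun x ζ => f (g₁ x ζ) (g₂ x ζ))) := by
  rw [aux_Hsp_iff] at hg
  obtain ⟨hgs, hgb⟩ := hg
  rw [aux_Hsp_iff, aux_Hsp_iff, aux_Esp_iff, aux_Esp_iff]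
  constructor
  · rintro ⟨hfs, hfb⟩
    refine ⟨hfs.comp hgs, fun k hk => ?_⟩
    have := aux_main σ κ w w' hσ.1 hκ _ _ hfs hgs C c r hC hc hr hlow hup hgb 1 le_rfl
      (by simpa using hfb) k hk
    simpa [Function.comp_def] using this
  · rintro ⟨hfs, hfb⟩
    refine ⟨hfs.comp hgs, fun k => ?_⟩
    have := aux_main σ κ w w' hσ.1 hκ _ _ hfs hgs C c r hC hc hr hlow hup hgb 0 zero_le_one
      (by simpa using hfb) k (Nat.zero_le _)
    simpa [Function.comp_def] using this
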